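/- Let m ≥ 3, let η be the Minkowski bilinear form on ℝ^m, let W be a finite-dimensional real inner product space, A : ℝ^m →ₗ[ℝ] W a linear map, κ ∈ ℝ with κ ≠ 0, and let R be a symmetric bilinear form on ℝ^m satisfying κ·R(u,w) = ⟪A u, A w⟫ for all u, w. Define the Einstein form G(u,w) := R(u,w) − (1/2)·(R(e₀,e₀) − ∑_{i=1}^{m−1} R(eᵢ,eᵢ))·η(u,w). Let l ∈ ℝ^m be lightlike, i.e. l ≠ 0 and η(l,l) = 0. Then the following are equivalent: (i) G(u,l) = 0 for all u ∈ ℝ^m; (ii) R(u,w)·η(l,z) = R(u,z)·η(l,w) for all u, w, z ∈ ℝ^m. -/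

import Mathlib

open scoped InnerProductSpace

noncomputable section

/-- The Minkowski bilinear form of signature `(+,-,...,-)` on `ℝ^m`:
`η(u,w) = u 0 * w 0 - ∑_{i=1}^{m-1} u i * w i`. -/
def mink (m : ℕ) (u w : Fin m → ℝ) : ℝ :=
  ∑ i : Fin m, if i.val = 0 then u i * w i else -(u i * w i)

/-- The standard basis of `ℝ^m`. -/
def stdb (m : ℕ) (a : Fin m) : Fin m → ℝ := Pi.single a 1

variable {W : Type*} [NormedAddCommGroup W] [InnerProductSpace ℝ W] [FiniteDimensional ℝ W]

theorem mink_eq (m : ℕ) [NeZero m] (u w : Fin m → ℝ) :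
    mink m u w = u 0 * w 0 - ∑ i ∈ Finset.univ.erase (0 : Fin m), u i * w i := by
  rw [mink, ← Finset.add_sum_erase _ _ (Finset.mem_univ (0 : Fin m)), sub_eq_add_neg,
    ← Finset.sum_neg_distrib]
  refine congrArg₂ _ (by simp) ?_
  refine Finset.sum_congr rfl fun i hi => if_neg fun h => Finset.ne_of_mem_erase hi ?_
  exact Fin.ext (by simpa using h)

theorem mink_stdb_zero (m : ℕ) [NeZero m] (l : Fin m → ℝ) : mink m l (stdb m 0) = l 0 := by
  rw [mink_eq, Finset.sum_eq_zero]
  · simp [stdb]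
  · intro i hi
    simp [stdb, Finset.ne_of_mem_erase hi]

theorem mink_stdb_of_ne_zero (m : ℕ) [NeZero m] (l : Fin m → ℝ) {i : Fin m} (hi : i ≠ 0) :
    mink m l (stdb m i) = -l i := by
  rw [mink_eq, Finset.sum_eq_single_of_mem i (by simp [hi])]
  · simp [stdb, hi.symm]
  · intro j _ hj
    simp [stdb, hj]

theorem mink_comm (m : ℕ) (u w : Fin m → ℝ) : mink m u w = mink m w u := by
  simp [mink, mul_comm]

/-- The time component of a lightlike vector does not vanish. -/
theorem lightlike_apply_zero_ne_zero (m : ℕ) [NeZero m] (l : Fin m → ℝ) (hl0 : l ≠ 0)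
    (hll : mink m l l = 0) : l 0 ≠ 0 := by
  intro h
  rw [mink_eq, h, mul_zero, zero_sub, neg_eq_zero,
    Finset.sum_eq_zero_iff_of_nonneg fun i _ => mul_self_nonneg (l i)] at hll
  refine hl0 (funext fun i => ?_)
  by_cases hi : i = 0
  · rw [hi, h]; rfl
  · exact mul_self_eq_zero.1 (hll i (by simp [hi]))

theorem map_eq_sum_stdb {V : Type*} [AddCommGroup V] [Module ℝ V] (m : ℕ) [NeZero m]
    (A : (Fin m → ℝ) →ₗ[ℝ] V) (u : Fin m → ℝ) :
    A u = u 0 • A (stdb m 0) +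
      ∑ i ∈ Finset.univ.erase (0 : Fin m), u i • A (stdb m i) := by
  rw [Finset.add_sum_erase _ (fun i => u i • A (stdb m i)) (Finset.mem_univ (0 : Fin m))]
  simp only [← map_smul, ← map_sum]
  congr 1
  ext j
  simp [stdb, Pi.single_apply]

/-- If `A` kills a lightlike vector `l` and `|A e₀|² = ∑ |A eᵢ|²`, then `A` has rank at most one
and factors through `η(l, ·)`. -/
theorem smul_map_eq_mink_smul {V : Type*} [NormedAddCommGroup V] [InnerProductSpace ℝ V]
    (m : ℕ) [NeZero m] (A : (Fin m → ℝ) →ₗ[ℝ] V) (l : Fin m → ℝ)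
    (hll : mink m l l = 0) (hAl : A l = 0)
    (htr : ⟪A (stdb m 0), A (stdb m 0)⟫_ℝ =
      ∑ i ∈ Finset.univ.erase (0 : Fin m), ⟪A (stdb m i), A (stdb m i)⟫_ℝ)
    (u : Fin m → ℝ) : l 0 • A u = mink m l u • A (stdb m 0) := by
  set S := Finset.univ.erase (0 : Fin m)
  set a := A (stdb m 0)
  have hl : ∑ i ∈ S, l i * l i = l 0 * l 0 := by
    rw [mink_eq] at hll
    exact (sub_eq_zero.1 hll).symm
  have hsum : ∑ i ∈ S, l i * ⟪A (stdb m i), a⟫_ℝ = -(l 0 * ⟪a, a⟫_ℝ) := by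
    have h := congrArg (fun v => ⟪v, a⟫_ℝ) ((map_eq_sum_stdb m A l).symm.trans hAl)
    simp only [inner_add_left, sum_inner, real_inner_smul_left, inner_zero_left] at h
    linarith
  have hsq : ∑ i ∈ S, ⟪l 0 • A (stdb m i) + l i • a, l 0 • A (stdb m i) + l i • a⟫_ℝ = 0 := by
    calc _ = ∑ i ∈ S, (l 0 * l 0 * ⟪A (stdb m i), A (stdb m i)⟫_ℝ +
          2 * l 0 * (l i * ⟪A (stdb m i), a⟫_ℝ) + l i * l i * ⟪a, a⟫_ℝ) := by
            refine Finset.sum_congr rfl fun i _ => ?_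
            simp only [inner_add_left, inner_add_right, real_inner_smul_left,
              real_inner_smul_right, real_inner_comm (A (stdb m i)) a]
            ring
      _ = 0 := by
            rw [Finset.sum_add_distrib, Finset.sum_add_distrib, ← Finset.mul_sum,
              ← Finset.mul_sum, ← Finset.sum_mul, ← htr, hsum, hl]
            ring
  rw [Finset.sum_eq_zero_iff_of_nonneg fun i _ => real_inner_self_nonneg] at hsq
  have hi : ∀ i ∈ S, l 0 • A (stdb m i) = -(l i • a) := fun i hi =>
    eq_neg_of_add_eq_zero_left (inner_self_eq_zero.1 (hsq i hi))
  rw [map_eq_sum_stdb m A u, smul_add, Finset.smul_sum, mink_eq, sub_smul, Finset.sum_smul,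
    sub_eq_add_neg, ← Finset.sum_neg_distrib, smul_smul]
  congr 1
  refine Finset.sum_congr rfl fun i h => ?_
  rw [smul_comm, hi i h, smul_neg, smul_smul, mul_comm]

/-- under the Einstein equation, the radiation conditions `G(·,l) = 0`
and `R_{a[b} l_{c]} = 0` for a lightlike vector `l` are equivalent. -/
theorem stmt14 (m : ℕ) [NeZero m] (hm : 3 ≤ m)
    (A : (Fin m → ℝ) →ₗ[ℝ] W) (κ : ℝ) (hκ : κ ≠ 0)
    (R : (Fin m → ℝ) →ₗ[ℝ] (Fin m → ℝ) →ₗ[ℝ] ℝ)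
    (hsym : ∀ u w : Fin m → ℝ, R u w = R w u)
    (hEin : ∀ u w : Fin m → ℝ, κ * R u w = ⟪A u, A w⟫_ℝ)
    (l : Fin m → ℝ) (hl0 : l ≠ 0) (hll : mink m l l = 0)
    (G : (Fin m → ℝ) → (Fin m → ℝ) → ℝ)
    (hG : ∀ u w : Fin m → ℝ, G u w = R u w -
      (1 / 2) * (R (stdb m 0) (stdb m 0) -
        ∑ i ∈ Finset.univ.erase (0 : Fin m), R (stdb m i) (stdb m i)) * mink m u w) :
    (∀ u : Fin m → ℝ, G u l = 0) ↔
      (∀ u w z : Fin m → ℝ, R u w * mink m l z = R u z * mink m l w) := by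
  have h0 := lightlike_apply_zero_ne_zero m l hl0 hll
  constructor
  · intro hGl
    have hRll : R l l = 0 := by simpa [hG, hll] using hGl l
    have hAl : A l = 0 := inner_self_eq_zero (𝕜 := ℝ).1 (by rw [← hEin, hRll, mul_zero])
    have hRl : ∀ u, R u l = 0 := fun u => by
      have h := hEin u l
      rw [hAl, inner_zero_right] at h
      exact (mul_eq_zero.1 h).resolve_left hκ
    have htr : R (stdb m 0) (stdb m 0) =
        ∑ i ∈ Finset.univ.erase (0 : Fin m), R (stdb m i) (stdb m i) := by
      have h := hGl (stdb m 0)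
      rw [hG, hRl, mink_comm, mink_stdb_zero, zero_sub, neg_eq_zero] at h
      have h' := (mul_eq_zero.1 h).resolve_right h0
      linarith
    have hA := smul_map_eq_mink_smul m A l hll hAl
      (by simp only [← hEin, ← Finset.mul_sum, htr])
    have hR : ∀ u w, l 0 * (κ * R u w) = mink m l w * ⟪A u, A (stdb m 0)⟫_ℝ := fun u w => by
      rw [hEin, ← real_inner_smul_right, hA, real_inner_smul_right]
    intro u w z
    refine mul_left_cancel₀ (mul_ne_zero h0 hκ) ?_
    linear_combination mink m l z * hR u w - mink m l w * hR u z
  · intro h u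
    have hR : ∀ u w, l 0 * R u w = R u (stdb m 0) * mink m l w := fun u w => by
      rw [← h, mink_stdb_zero, mul_comm]
    have hRl : R u l = 0 := by
      have h' := hR u l
      rw [hll, mul_zero] at h'
      exact (mul_eq_zero.1 h').resolve_left h0
    have hdiag : ∀ i ∈ Finset.univ.erase (0 : Fin m),
        l 0 * l 0 * R (stdb m i) (stdb m i) = l i * l i * R (stdb m 0) (stdb m 0) := by
      intro i hi
      have h1 := hR (stdb m i) (stdb m i)
      have h2 := hR (stdb m 0) (stdb m i)
      rw [mink_stdb_of_ne_zero m l (Finset.ne_of_mem_erase hi)] at h1 h2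
      rw [hsym (stdb m 0)] at h2
      linear_combination l 0 * h1 - l i * h2
    have htr : R (stdb m 0) (stdb m 0) =
        ∑ i ∈ Finset.univ.erase (0 : Fin m), R (stdb m i) (stdb m i) := by
      refine mul_left_cancel₀ (mul_ne_zero h0 h0) ?_
      rw [Finset.mul_sum, Finset.sum_congr rfl hdiag, ← Finset.sum_mul]
      rw [mink_eq] at hll
      rw [sub_eq_zero.1 hll]
    rw [hG, hRl, ← htr]
    ring
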